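/- There is a universal constant C such that the following holds. Let A ⊆ {−1,1}^n be a half-space, let f : {−1,1}^n → [0,1], and let t > 0. Then Var(P_t f) ≥ 4 Cov(1_A, f)² − C t^{1/4}. -/

import Mathlib

open Real

/-- The `±1` value of a boolean coordinate. -/
noncomputable def bval (b : Bool) : ℝ := if b then 1 else -1

/-- Expectation with respect to the uniform measure on the discrete cube `{-1,1}^n`. -/
noncomputable def bExp (n : ℕ) (f : (Fin n → Bool) → ℝ) : ℝ :=
  (∑ x : Fin n → Bool, f x) / 2 ^ n

/-- Covariance on the discrete cube. -/
noncomputable def bCov (n : ℕ) (f g : (Fin n → Bool) → ℝ) : ℝ :=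
  bExp n (fun x => (f x - bExp n f) * (g x - bExp n g))

/-- Variance on the discrete cube. -/
noncomputable def bVar (n : ℕ) (f : (Fin n → Bool) → ℝ) : ℝ := bCov n f f

/-- The character `χ_S(x) = ∏_{i ∈ S} x_i`. -/
noncomputable def chi (n : ℕ) (S : Finset (Fin n)) (x : Fin n → Bool) : ℝ :=
  ∏ i ∈ S, bval (x i)

/-- The Fourier coefficient `f̂(S) = E[f χ_S]`. -/
noncomputable def fourierCoef (n : ℕ) (f : (Fin n → Bool) → ℝ) (S : Finset (Fin n)) : ℝ :=
  bExp n (fun x => f x * chi n S x)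

/-- The Bonami--Beckner semigroup `P_t f = Σ_S e^{-t|S|} f̂(S) χ_S`. -/
noncomputable def bP (n : ℕ) (t : ℝ) (f : (Fin n → Bool) → ℝ) : (Fin n → Bool) → ℝ :=
  fun x => ∑ S : Finset (Fin n), Real.exp (-t * S.card) * fourierCoef n f S * chi n S x

/-- A half-space `{x : ⟨a, x⟩ ≤ b}` in `{-1,1}^n`. -/
def IsHalfspaceB {n : ℕ} (A : Set (Fin n → Bool)) : Prop :=
  ∃ (a : Fin n → ℝ) (b : ℝ), A = {x | ∑ i, a i * bval (x i) ≤ b}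

/-- `M(g)`: the supremum over half-spaces `A` of `Cov(g, 1_A)`. -/
noncomputable def Mb (n : ℕ) (g : (Fin n → Bool) → ℝ) : ℝ :=
  ⨆ A : {A : Set (Fin n → Bool) // IsHalfspaceB A}, bCov n g (Set.indicator A.1 1)

/-- `z ⊘ x`: coordinates where `z` is `none` (i.e. 0) are filled in by `x`. -/
def oslash {n : ℕ} (z : Fin n → Option Bool) (x : Fin n → Bool) : Fin n → Bool :=
  fun i => (z i).getD (x i)

/-- The restriction `f_z(x) = f(z ⊘ x)`. -/
noncomputable def restrictF {n : ℕ} (f : (Fin n → Bool) → ℝ) (z : Fin n → Option Bool) :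
    (Fin n → Bool) → ℝ := fun x => f (oslash z x)

/-- The `μ_s`-probability of the restriction pattern `z ∈ {-1,0,1}^n`: each coordinate is
independently `0` (here `none`) with probability `e^{-s}`, and `±1` with probability
`(1-e^{-s})/2` each. -/
noncomputable def muWeight (n : ℕ) (s : ℝ) (z : Fin n → Option Bool) : ℝ :=
  ∏ i, if z i = none then Real.exp (-s) else (1 - Real.exp (-s)) / 2

/-- Expectation over a random restriction `Z ∼ μ_s`. -/
noncomputable def restExp (n : ℕ) (s : ℝ) (g : (Fin n → Option Bool) → ℝ) : ℝ :=
  ∑ z : Fin n → Option Bool, muWeight n s z * g z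

/-- `w₁(f) = Σ_i f̂({i})²`. -/
noncomputable def w1b (n : ℕ) (f : (Fin n → Bool) → ℝ) : ℝ :=
  ∑ i : Fin n, (fourierCoef n f {i}) ^ 2

/-- The boolean version of the ball example: `n = m²`, the coordinates are split into `m`
consecutive blocks `J_i = {j : j / m = i}` of size `m`, and
`B^{(m)} = {x : Σ_i (m^{-1/2} Σ_{j ∈ J_i} x_j)² ≤ m}`. -/
noncomputable def Bm (m : ℕ) : Set (Fin (m*m) → Bool) :=
  {x | ∑ i : Fin m,
    ((∑ j : Fin (m*m), if (j : ℕ) / m = (i : ℕ) then bval (x j) else 0) / Real.sqrt m) ^ 2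
      ≤ (m : ℝ)}

lemma bval_sq (b : Bool) : bval b * bval b = 1 := by cases b <;> simp [bval]

lemma bval_not (b : Bool) : bval (!b) = - bval b := by cases b <;> simp [bval]

lemma chi_empty (n : ℕ) (x : Fin n → Bool) : chi n ∅ x = 1 := by simp [chi]

lemma bExp_add (n : ℕ) (f g : (Fin n → Bool) → ℝ) :
    bExp n (fun x => f x + g x) = bExp n f + bExp n g := by
  simp [bExp, Finset.sum_add_distrib, add_div]

lemma bExp_sub (n : ℕ) (f g : (Fin n → Bool) → ℝ) :
    bExp n (fun x => f x - g x) = bExp n f - bExp n g := by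
  simp [bExp, Finset.sum_sub_distrib, sub_div]

lemma bExp_mul_left (n : ℕ) (c : ℝ) (f : (Fin n → Bool) → ℝ) :
    bExp n (fun x => c * f x) = c * bExp n f := by
  simp [bExp, ← Finset.mul_sum, mul_div_assoc]

lemma bExp_const (n : ℕ) (c : ℝ) : bExp n (fun _ => c) = c := by
  simp [bExp]

lemma bExp_sum {ι : Type*} (n : ℕ) (s : Finset ι) (f : ι → (Fin n → Bool) → ℝ) :
    bExp n (fun x => ∑ i ∈ s, f i x) = ∑ i ∈ s, bExp n (f i) := by
  simp only [bExp]
  rw [Finset.sum_comm, Finset.sum_div]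

lemma bExp_mono (n : ℕ) {f g : (Fin n → Bool) → ℝ} (h : ∀ x, f x ≤ g x) :
    bExp n f ≤ bExp n g := by
  unfold bExp
  gcongr with x
  exact h x

lemma bExp_equiv (n : ℕ) (σ : (Fin n → Bool) → (Fin n → Bool)) (hσ : Function.Involutive σ)
    (f : (Fin n → Bool) → ℝ) : bExp n (fun x => f (σ x)) = bExp n f := by
  unfold bExp
  congr 1
  exact Equiv.sum_comp hσ.toPerm f

lemma bCov_eq (n : ℕ) (f g : (Fin n → Bool) → ℝ) :
    bCov n f g = bExp n (fun x => f x * g x) - bExp n f * bExp n g := by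
  unfold bCov
  have : (fun x => (f x - bExp n f) * (g x - bExp n g)) =
      fun x => (f x * g x - bExp n g * f x) - (bExp n f * g x - bExp n f * bExp n g) := by
    funext x; ring
  rw [this, bExp_sub, bExp_sub, bExp_sub, bExp_mul_left, bExp_mul_left, bExp_const]
  ring

lemma chi_kernel (n : ℕ) (x y : Fin n → Bool) :
    ∑ S : Finset (Fin n), chi n S x * chi n S y = if x = y then 2 ^ n else 0 := by
  have h1 : ∑ S : Finset (Fin n), chi n S x * chi n S y
      = ∏ i, (1 + bval (x i) * bval (y i)) := by
    rw [Finset.prod_one_add]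
    simp [chi, Finset.prod_mul_distrib]
  rw [h1]
  split_ifs with h
  · subst h
    simp [bval_sq]; norm_num
  · obtain ⟨i, hi⟩ := Function.ne_iff.mp h
    apply Finset.prod_eq_zero (Finset.mem_univ i)
    revert hi
    cases x i <;> cases y i <;> simp [bval]

lemma plancherel (n : ℕ) (f g : (Fin n → Bool) → ℝ) :
    bExp n (fun x => f x * g x) = ∑ S, fourierCoef n f S * fourierCoef n g S := by
  have h : ∑ S, fourierCoef n f S * fourierCoef n g S
      = (∑ x, ∑ y, f x * g y * ∑ S : Finset (Fin n), chi n S x * chi n S y) / (2 ^ n * 2 ^ n) := by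
    simp only [fourierCoef, bExp, div_mul_div_comm]
    rw [← Finset.sum_div]
    congr 1
    simp only [Finset.sum_mul_sum]
    simp only [Finset.mul_sum]
    rw [Finset.sum_comm]
    refine Finset.sum_congr rfl fun x _ => ?_
    rw [Finset.sum_comm]
    refine Finset.sum_congr rfl fun y _ => ?_
    refine Finset.sum_congr rfl fun S _ => ?_
    ring
  rw [h]
  simp only [chi_kernel, mul_ite, mul_zero, Finset.sum_ite_eq, Finset.mem_univ, if_true]
  rw [← Finset.sum_mul, bExp]
  field_simp

lemma chi_orth (n : ℕ) (S T : Finset (Fin n)) :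
    bExp n (fun x => chi n S x * chi n T x) = if S = T then 1 else 0 := by
  have h1 : ∀ x, chi n S x * chi n T x =
      ∏ i, ((if i ∈ S then bval (x i) else 1) * (if i ∈ T then bval (x i) else 1)) := by
    intro x
    rw [Finset.prod_mul_distrib]
    simp [chi, Finset.prod_ite_mem]
  have h2 : ∑ x : Fin n → Bool, chi n S x * chi n T x = ∏ i : Fin n, ∑ b : Bool,
      ((if i ∈ S then bval b else 1) * (if i ∈ T then bval b else 1)) := by
    simp only [h1]
    rw [Finset.prod_univ_sum, Fintype.piFinset_univ]
  unfold bExp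
  rw [h2]
  split_ifs with h
  · subst h
    have : ∀ i, ∑ b : Bool, ((if i ∈ S then bval b else 1) * (if i ∈ S then bval b else 1))
        = 2 := by
      intro i
      by_cases hi : i ∈ S <;> simp [hi, bval] <;> norm_num
    rw [Finset.prod_congr rfl (fun i _ => this i)]
    simp
  · have : ∃ i, ¬ (i ∈ S ↔ i ∈ T) := by
      by_contra hc
      push Not at hc
      exact h (Finset.ext hc)
    obtain ⟨i, hi⟩ := this
    rw [Finset.prod_eq_zero (Finset.mem_univ i), zero_div]
    by_cases h1 : i ∈ S <;> by_cases h2 : i ∈ T <;> simp [h1, h2, bval] <;> simp_all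

lemma fourierCoef_bP (n : ℕ) (t : ℝ) (f : (Fin n → Bool) → ℝ) (S : Finset (Fin n)) :
    fourierCoef n (bP n t f) S = Real.exp (-t * S.card) * fourierCoef n f S := by
  conv_lhs => unfold fourierCoef bP
  simp only [Finset.sum_mul]
  rw [bExp_sum]
  simp only [mul_assoc, bExp_mul_left, chi_orth]
  simp

lemma fourierCoef_empty (n : ℕ) (f : (Fin n → Bool) → ℝ) :
    fourierCoef n f ∅ = bExp n f := by
  simp [fourierCoef, chi_empty]

lemma bCov_fourier (n : ℕ) (f g : (Fin n → Bool) → ℝ) :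
    bCov n f g = ∑ S ∈ Finset.univ.erase ∅, fourierCoef n f S * fourierCoef n g S := by
  rw [bCov_eq, plancherel, ← fourierCoef_empty, ← fourierCoef_empty,
    ← Finset.add_sum_erase _ _ (Finset.mem_univ (∅ : Finset (Fin n)))]
  ring

/-- Flip the `j`-th block of coordinates. -/
def blockFlip {n m : ℕ} (κ : Fin n → Fin m) (j : Fin m) (x : Fin n → Bool) : Fin n → Bool :=
  fun i => if κ i = j then !(x i) else x i

lemma blockFlip_invol {n m : ℕ} (κ : Fin n → Fin m) (j : Fin m) :
    Function.Involutive (blockFlip κ j) := by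
  intro x; funext i
  by_cases h : κ i = j <;> simp [blockFlip, h]

lemma chi_blockFlip {n m : ℕ} (κ : Fin n → Fin m) (j : Fin m) (S : Finset (Fin n))
    (x : Fin n → Bool) :
    chi n S (blockFlip κ j x) = (∏ i ∈ S, if κ i = j then (-1 : ℝ) else 1) * chi n S x := by
  unfold chi
  rw [← Finset.prod_mul_distrib]
  refine Finset.prod_congr rfl fun i _ => ?_
  by_cases h : κ i = j <;> simp [blockFlip, h, bval_not]

lemma fourierCoef_blockFlip {n m : ℕ} (κ : Fin n → Fin m) (j : Fin m)
    (g : (Fin n → Bool) → ℝ) (S : Finset (Fin n)) :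
    fourierCoef n (fun x => g (blockFlip κ j x)) S
      = (∏ i ∈ S, if κ i = j then (-1 : ℝ) else 1) * fourierCoef n g S := by
  unfold fourierCoef
  rw [← bExp_mul_left, ← bExp_equiv n _ (blockFlip_invol κ j)]
  congr 1
  funext x
  dsimp only
  rw [blockFlip_invol κ j x, chi_blockFlip]
  ring

lemma blockFlip_diff {n m : ℕ} (κ : Fin n → Fin m) (j : Fin m) (g : (Fin n → Bool) → ℝ) :
    bExp n (fun x => (g x - g (blockFlip κ j x)) ^ 2)
      = 2 * ∑ S, (1 - ∏ i ∈ S, if κ i = j then (-1 : ℝ) else 1) * fourierCoef n g S ^ 2 := by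
  have h : (fun x => (g x - g (blockFlip κ j x)) ^ 2) = fun x =>
      (g x * g x - 2 * (g x * g (blockFlip κ j x)))
        + (fun y => g y * g y) (blockFlip κ j x) := by
    funext x; ring
  rw [h, bExp_add, bExp_equiv n _ (blockFlip_invol κ j) (fun y => g y * g y), bExp_sub, bExp_mul_left,
    plancherel n g g, plancherel n g (fun x => g (blockFlip κ j x))]
  simp only [fourierCoef_blockFlip]
  have : ∑ S, (1 - ∏ i ∈ S, if κ i = j then (-1 : ℝ) else 1) * fourierCoef n g S ^ 2
    = ∑ S, fourierCoef n g S * fourierCoef n g S -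
      ∑ S, fourierCoef n g S * ((∏ i ∈ S, if κ i = j then (-1 : ℝ) else 1)
        * fourierCoef n g S) := by
    rw [← Finset.sum_sub_distrib]
    exact Finset.sum_congr rfl fun S _ => by ring
  rw [this]
  ring

lemma avg_partition {n m : ℕ} (hm : 0 < m) (j : Fin m) (S : Finset (Fin n)) :
    ∑ κ : Fin n → Fin m, (∏ i ∈ S, if κ i = j then (-1 : ℝ) else 1)
      = (m : ℝ) ^ n * (1 - 2 / m) ^ S.card := by
  have h1 : ∀ κ : Fin n → Fin m, (∏ i ∈ S, if κ i = j then (-1 : ℝ) else 1)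
      = ∏ i, (if i ∈ S then (if κ i = j then (-1 : ℝ) else 1) else 1) := by
    intro κ
    simp [Finset.prod_ite_mem]
  have hm' : (m : ℝ) ≠ 0 := by positivity
  have h2 : ∀ i : Fin n, ∑ k : Fin m, (if i ∈ S then (if k = j then (-1 : ℝ) else 1) else 1)
      = m * (if i ∈ S then (1 - 2 / m : ℝ) else 1) := by
    intro i
    by_cases hi : i ∈ S
    · simp only [hi, if_true]
      have : ∀ k : Fin m, (if k = j then (-1 : ℝ) else 1) = 1 - (if k = j then 2 else 0) := by
        intro k; split_ifs <;> norm_num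
      simp only [this, Finset.sum_sub_distrib]
      simp
      field_simp
    · simp [hi]
  simp only [h1]
  rw [← Fintype.piFinset_univ, ← Finset.prod_univ_sum (fun _ => Finset.univ)
    (fun i k => if i ∈ S then (if k = j then (-1 : ℝ) else 1) else 1)]
  simp only [h2]
  rw [Finset.prod_mul_distrib]
  simp [Finset.prod_ite_mem]

/-- The linear form restricted to block `j`. -/
noncomputable def blockForm {n m : ℕ} (κ : Fin n → Fin m) (a : Fin n → ℝ) (j : Fin m)
    (x : Fin n → Bool) : ℝ := ∑ i, if κ i = j then a i * bval (x i) else 0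

/-- Real valued sign of a block form. -/
noncomputable def blockSign {n m : ℕ} (κ : Fin n → Fin m) (a : Fin n → ℝ) (j : Fin m)
    (x : Fin n → Bool) : ℝ :=
  if 0 < blockForm κ a j x then 1 else if blockForm κ a j x < 0 then -1 else 0

lemma blockForm_flip {n m : ℕ} (κ : Fin n → Fin m) (a : Fin n → ℝ) (j : Fin m)
    (x : Fin n → Bool) : blockForm κ a j (blockFlip κ j x) = - blockForm κ a j x := by
  unfold blockForm
  rw [← Finset.sum_neg_distrib]
  refine Finset.sum_congr rfl fun i _ => ?_
  by_cases h : κ i = j <;> simp [blockFlip, h, bval_not]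

lemma blockForm_flip_ne {n m : ℕ} (κ : Fin n → Fin m) (a : Fin n → ℝ) (j k : Fin m)
    (hjk : k ≠ j) (x : Fin n → Bool) :
    blockForm κ a k (blockFlip κ j x) = blockForm κ a k x := by
  unfold blockForm
  refine Finset.sum_congr rfl fun i _ => ?_
  by_cases h : κ i = k
  · have : κ i ≠ j := by rw [h]; exact hjk
    simp [blockFlip, h, hjk]
  · simp [h]

lemma blockSign_flip {n m : ℕ} (κ : Fin n → Fin m) (a : Fin n → ℝ) (j : Fin m)
    (x : Fin n → Bool) : blockSign κ a j (blockFlip κ j x) = - blockSign κ a j x := by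
  unfold blockSign
  rw [blockForm_flip]
  split_ifs <;> first | linarith | norm_num

lemma blockSign_flip_ne {n m : ℕ} (κ : Fin n → Fin m) (a : Fin n → ℝ) (j k : Fin m)
    (hjk : k ≠ j) (x : Fin n → Bool) :
    blockSign κ a k (blockFlip κ j x) = blockSign κ a k x := by
  unfold blockSign
  rw [blockForm_flip_ne κ a j k hjk]

lemma linear_flip {n m : ℕ} (κ : Fin n → Fin m) (a : Fin n → ℝ) (j : Fin m)
    (x : Fin n → Bool) : ∑ i, a i * bval (blockFlip κ j x i)
      = ∑ i, a i * bval (x i) - 2 * blockForm κ a j x := by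
  unfold blockForm
  rw [Finset.mul_sum, ← Finset.sum_sub_distrib]
  refine Finset.sum_congr rfl fun i _ => ?_
  by_cases h : κ i = j <;> simp [blockFlip, h, bval_not]
  ring

lemma sq_eq_sign {n m : ℕ} (κ : Fin n → Fin m) (a : Fin n → ℝ) (b : ℝ) (j : Fin m)
    (g : (Fin n → Bool) → ℝ) (hg : g = fun x => if ∑ i, a i * bval (x i) ≤ b then 1 else 0)
    (x : Fin n → Bool) :
    (g x - g (blockFlip κ j x)) ^ 2
      = blockSign κ a j x * (g (blockFlip κ j x) - g x) := by
  subst hg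
  simp only [linear_flip, blockSign]
  split_ifs <;> first | linarith | norm_num

lemma sign_moment {n m : ℕ} (κ : Fin n → Fin m) (a : Fin n → ℝ) :
    bExp n (fun x => (∑ j, blockSign κ a j x) ^ 2) ≤ m := by
  have h : (fun x => (∑ j, blockSign κ a j x) ^ 2) = fun x => ∑ j, ∑ k,
      blockSign κ a j x * blockSign κ a k x := by
    funext x; rw [sq, Finset.sum_mul_sum]
  rw [h, bExp_sum]
  have h2 : ∀ j, bExp n (fun x => ∑ k, blockSign κ a j x * blockSign κ a k x) ≤ 1 := by
    intro j
    rw [bExp_sum, Finset.sum_eq_single j]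
    · rw [← bExp_const n 1]
      apply bExp_mono
      intro x
      unfold blockSign
      split_ifs <;> norm_num
    · intro k _ hk
      have := bExp_equiv n _ (blockFlip_invol κ j) (fun x => blockSign κ a j x * blockSign κ a k x)
      simp only [blockSign_flip, blockSign_flip_ne κ a j k hk] at this
      have h3 : (fun x => -blockSign κ a j x * blockSign κ a k x)
        = fun x => (-1) * (blockSign κ a j x * blockSign κ a k x) := by funext x; ring
      rw [h3, bExp_mul_left] at this
      linarith
    · simp
  calc _ ≤ ∑ j : Fin m, (1 : ℝ) := Finset.sum_le_sum fun j _ => h2 j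
    _ = m := by simp

lemma bExp_le_sqrt (n : ℕ) (f : (Fin n → Bool) → ℝ) (c : ℝ)
    (h : bExp n (fun x => f x ^ 2) ≤ c ^ 2) (hc : 0 < c) : bExp n (fun x => |f x|) ≤ c := by
  have h1 : bExp n (fun x => |f x|) ≤ bExp n (fun x => (1 / (2 * c)) * f x ^ 2 + c / 2) := by
    apply bExp_mono
    intro x
    have : (1 / (2 * c)) * f x ^ 2 + c / 2 - |f x| = (|f x| - c) ^ 2 / (2 * c) := by
      rw [← sq_abs]; field_simp; ring
    have : 0 ≤ (|f x| - c) ^ 2 / (2 * c) := by positivity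
    linarith
  rw [bExp_add, bExp_mul_left, bExp_const] at h1
  have h2 : (1 / (2 * c)) * bExp n (fun x => f x ^ 2) ≤ (1 / (2 * c)) * c ^ 2 := by gcongr
  have h3 : (1 / (2 * c)) * c ^ 2 = c / 2 := by field_simp
  linarith

lemma sum_diff_le {n m : ℕ} (hm : 0 < m) (κ : Fin n → Fin m) (a : Fin n → ℝ) (b : ℝ)
    (g : (Fin n → Bool) → ℝ) (hg : g = fun x => if ∑ i, a i * bval (x i) ≤ b then 1 else 0) :
    ∑ j, bExp n (fun x => (g x - g (blockFlip κ j x)) ^ 2) ≤ 2 * √m := by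
  have h1 : ∀ j, bExp n (fun x => (g x - g (blockFlip κ j x)) ^ 2)
      = (-2) * bExp n (fun x => blockSign κ a j x * g x) := by
    intro j
    simp only [sq_eq_sign κ a b j g hg, mul_sub]
    rw [bExp_sub]
    have := bExp_equiv n _ (blockFlip_invol κ j) (fun x => blockSign κ a j x * g x)
    simp only [blockSign_flip] at this
    have h3 : (fun x => -blockSign κ a j x * g (blockFlip κ j x))
        = fun x => (-1) * (blockSign κ a j x * g (blockFlip κ j x)) := by funext x; ring
    rw [h3, bExp_mul_left] at this
    linarith
  simp only [h1]
  rw [← Finset.mul_sum, ← bExp_sum, ← bExp_mul_left]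
  have h2 := bExp_le_sqrt n (fun x => ∑ j, blockSign κ a j x) (√m)
    (by rw [Real.sq_sqrt (by positivity)]; exact sign_moment κ a) (by positivity)
  refine le_trans ?_ (mul_le_mul_of_nonneg_left h2 zero_le_two)
  rw [← bExp_mul_left]
  apply bExp_mono
  intro x
  rw [← Finset.sum_mul]
  have hg0 : g x = 0 ∨ g x = 1 := by
    subst hg; dsimp only; split_ifs <;> simp
  rcases hg0 with h | h <;> rw [h]
  · simp
  · have := neg_abs_le (∑ j, blockSign κ a j x)
    linarith

lemma peres {n m : ℕ} (hm : 0 < m) (a : Fin n → ℝ) (b : ℝ)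
    (g : (Fin n → Bool) → ℝ) (hg : g = fun x => if ∑ i, a i * bval (x i) ≤ b then 1 else 0) :
    √m * ∑ S, (1 - (1 - 2 / m : ℝ) ^ S.card) * fourierCoef n g S ^ 2 ≤ 1 := by
  have h1 : ∑ κ : Fin n → Fin m, ∑ j, bExp n (fun x => (g x - g (blockFlip κ j x)) ^ 2)
      ≤ (m : ℝ) ^ n * (2 * √m) := by
    calc _ ≤ ∑ κ : Fin n → Fin m, 2 * √m :=
          Finset.sum_le_sum fun κ _ => sum_diff_le hm κ a b g hg
      _ = _ := by simp
  have h2 : ∑ κ : Fin n → Fin m, ∑ j, bExp n (fun x => (g x - g (blockFlip κ j x)) ^ 2)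
      = m * (2 * ((m : ℝ) ^ n * ∑ S, (1 - (1 - 2 / m : ℝ) ^ S.card) * fourierCoef n g S ^ 2)) := by
    rw [Finset.sum_comm]
    have : ∀ j : Fin m, ∑ κ : Fin n → Fin m, bExp n (fun x => (g x - g (blockFlip κ j x)) ^ 2)
        = 2 * ((m : ℝ) ^ n * ∑ S, (1 - (1 - 2 / m : ℝ) ^ S.card) * fourierCoef n g S ^ 2) := by
      intro j
      simp only [blockFlip_diff]
      rw [← Finset.mul_sum, Finset.sum_comm]
      congr 1
      rw [Finset.mul_sum]
      refine Finset.sum_congr rfl fun S _ => ?_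
      rw [← Finset.sum_mul, Finset.sum_sub_distrib, avg_partition hm]
      simp
      ring
    simp [this]
  rw [h2] at h1
  set W := ∑ S, (1 - (1 - 2 / m : ℝ) ^ S.card) * fourierCoef n g S ^ 2
  have hm0 : (0 : ℝ) < m := by positivity
  have hs : 0 < √(m : ℝ) := by positivity
  have hss : √(m : ℝ) * √m = m := Real.mul_self_sqrt hm0.le
  have hp : (0 : ℝ) < (m : ℝ) ^ n := by positivity
  have h3 : (2 * (m : ℝ) ^ n * √m) * (√m * W) ≤ (2 * (m : ℝ) ^ n * √m) * 1 := by
    calc _ = 2 * (m : ℝ) ^ n * (√m * √m) * W := by ring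
      _ = m * (2 * ((m : ℝ) ^ n * W)) := by rw [hss]; ring
      _ ≤ _ := h1
      _ = _ := by ring
  exact le_of_mul_le_mul_left h3 (by positivity)

lemma parseval_le_one (n : ℕ) (f : (Fin n → Bool) → ℝ) (hf : ∀ x, f x ∈ Set.Icc (0:ℝ) 1) :
    ∑ S, fourierCoef n f S ^ 2 ≤ 1 := by
  have h := plancherel n f f
  simp only [sq]
  rw [← h, ← bExp_const n 1]
  apply bExp_mono
  intro x
  have := hf x
  nlinarith [this.1, this.2]

lemma var_le (n : ℕ) (f : (Fin n → Bool) → ℝ) (hf : ∀ x, f x ∈ Set.Icc (0:ℝ) 1) :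
    ∑ S ∈ Finset.univ.erase ∅, fourierCoef n f S ^ 2 ≤ 1 / 4 := by
  have h := bCov_fourier n f f
  simp only [sq]
  rw [← h, bCov_eq]
  have : bExp n (fun x => f x * f x) ≤ bExp n f := by
    apply bExp_mono
    intro x
    have := hf x
    nlinarith [this.1, this.2]
  nlinarith [sq_nonneg (bExp n f - 1 / 2)]

lemma noise_le {n : ℕ} (a : Fin n → ℝ) (b : ℝ) (t : ℝ) (ht : 0 < t)
    (g : (Fin n → Bool) → ℝ) (hg : g = fun x => if ∑ i, a i * bval (x i) ≤ b then 1 else 0) :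
    ∑ S, (1 - Real.exp (-t * S.card)) * fourierCoef n g S ^ 2 ≤ √t := by
  rcases le_or_gt t 1 with h1 | h1
  · set m := ⌊2 / t⌋₊ with hm
    have hm2 : 2 ≤ m := by
      apply Nat.le_floor
      rw [le_div_iff₀ ht]; push_cast; linarith
    have hmu : (m : ℝ) ≤ 2 / t := Nat.floor_le (by positivity)
    have hml : 2 / t < m + 1 := Nat.lt_floor_add_one _
    have hm0 : (0 : ℝ) < m := by positivity
    have hm2' : (2 : ℝ) ≤ m := by exact_mod_cast hm2
    have htm : t ≤ 2 / m := by
      rw [le_div_iff₀ ht] at hmu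
      rw [le_div_iff₀ hm0]; linarith
    have hmt : 1 ≤ t * m := by
      rw [div_lt_iff₀ ht] at hml
      nlinarith
    have hρ : 0 ≤ 1 - 2 / (m : ℝ) := by
      have : 2 / (m : ℝ) ≤ 1 := by rw [div_le_one hm0]; exact hm2'
      linarith
    have hexp : 1 - 2 / (m : ℝ) ≤ Real.exp (-t) := by
      have := Real.add_one_le_exp (-t)
      linarith
    have hp := peres (by omega : 0 < m) a b g hg
    have hle : ∑ S, (1 - Real.exp (-t * S.card)) * fourierCoef n g S ^ 2
        ≤ ∑ S, (1 - (1 - 2 / m : ℝ) ^ S.card) * fourierCoef n g S ^ 2 := by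
      refine Finset.sum_le_sum fun S _ => ?_
      refine mul_le_mul_of_nonneg_right ?_ (sq_nonneg _)
      have : Real.exp (-t * S.card) = Real.exp (-t) ^ S.card := by
        rw [← Real.exp_nat_mul]; ring_nf
      rw [this]
      have := pow_le_pow_left₀ hρ hexp S.card
      linarith
    refine hle.trans ?_
    have hs : 0 < √(m : ℝ) := by positivity
    have h4 : 1 ≤ √(m : ℝ) * √t := by
      rw [← Real.sqrt_mul hm0.le, Real.one_le_sqrt]; linarith
    exact le_of_mul_le_mul_left (hp.trans h4) hs
  · have hg1 : ∀ x, g x ∈ Set.Icc (0:ℝ) 1 := by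
      intro x; subst hg; dsimp only; split_ifs <;> simp
    calc _ ≤ ∑ S, fourierCoef n g S ^ 2 := by
          refine Finset.sum_le_sum fun S _ => ?_
          have := Real.exp_pos (-t * S.card)
          nlinarith [sq_nonneg (fourierCoef n g S)]
      _ ≤ 1 := parseval_le_one n g hg1
      _ ≤ √t := by rw [Real.one_le_sqrt]; exact h1.le

theorem stmt18 : ∃ C : ℝ, ∀ (n : ℕ) (A : Set (Fin n → Bool))
    (f : (Fin n → Bool) → ℝ) (t : ℝ),
    IsHalfspaceB A → (∀ x, f x ∈ Set.Icc (0:ℝ) 1) → 0 < t →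
    bVar n (bP n t f) ≥ 4 * (bCov n (Set.indicator A 1) f) ^ 2 - C * t ^ ((1:ℝ)/4) := by
  refine ⟨8, fun n A f t hA hf ht => ?_⟩
  obtain ⟨a, b, hab⟩ := hA
  set g : (Fin n → Bool) → ℝ := Set.indicator A 1 with hgdef
  have hg : g = fun x => if ∑ i, a i * bval (x i) ≤ b then 1 else 0 := by
    funext x
    rw [hgdef, hab]
    simp [Set.indicator_apply]
  have hg1 : ∀ x, g x ∈ Set.Icc (0:ℝ) 1 := by
    intro x; rw [hg]; dsimp only; split_ifs <;> simp
  have hnoise := noise_le a b t ht g hg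
  have hVg := var_le n g hg1
  have hVf := var_le n f hf
  have hV : bVar n (bP n t f)
      = ∑ S ∈ Finset.univ.erase ∅, (Real.exp (-t * S.card) * fourierCoef n f S) ^ 2 := by
    rw [bVar, bCov_fourier]
    simp only [fourierCoef_bP, sq]
  have he0 : ∀ S : Finset (Fin n), 0 < Real.exp (-t * S.card) := fun S => Real.exp_pos _
  have he1 : ∀ S : Finset (Fin n), Real.exp (-t * S.card) ≤ 1 := by
    intro S
    rw [Real.exp_le_one_iff]
    have : (0:ℝ) ≤ S.card := by positivity
    nlinarith
  set p := ∑ S ∈ Finset.univ.erase ∅,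
    fourierCoef n g S * (Real.exp (-t * S.card) * fourierCoef n f S) with hp
  set q := ∑ S ∈ Finset.univ.erase ∅,
    ((1 - Real.exp (-t * S.card)) * fourierCoef n g S) * fourierCoef n f S with hq
  have hc : bCov n g f = p + q := by
    rw [bCov_fourier, hp, hq, ← Finset.sum_add_distrib]
    exact Finset.sum_congr rfl fun S _ => by ring
  have hVn : 0 ≤ bVar n (bP n t f) := by
    rw [hV]; exact Finset.sum_nonneg fun S _ => sq_nonneg _
  have hVle : bVar n (bP n t f) ≤ 1 / 4 := by
    rw [hV]
    refine le_trans (Finset.sum_le_sum fun S _ => ?_) hVf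
    rw [mul_pow]
    have := pow_le_one₀ (n := 2) (he0 S).le (he1 S)
    nlinarith [sq_nonneg (fourierCoef n f S)]
  have hp2 : p ^ 2 ≤ 1 / 4 * bVar n (bP n t f) := by
    have := Finset.sum_mul_sq_le_sq_mul_sq (Finset.univ.erase (∅ : Finset (Fin n)))
      (fun S => fourierCoef n g S) (fun S => Real.exp (-t * S.card) * fourierCoef n f S)
    rw [← hV] at this
    exact this.trans (mul_le_mul_of_nonneg_right hVg hVn)
  have hsum : ∑ S ∈ Finset.univ.erase ∅, ((1 - Real.exp (-t * S.card)) * fourierCoef n g S) ^ 2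
      ≤ √t := by
    refine le_trans (le_trans (Finset.sum_le_sum_of_subset_of_nonneg
      (Finset.erase_subset ∅ Finset.univ) fun S _ _ => sq_nonneg _)
      (Finset.sum_le_sum fun S _ => ?_)) hnoise
    rw [mul_pow]
    have h0 := he0 S
    have h1 := he1 S
    refine mul_le_mul_of_nonneg_right ?_ (sq_nonneg _)
    nlinarith
  have hsum1 : ∑ S ∈ Finset.univ.erase ∅, ((1 - Real.exp (-t * S.card)) * fourierCoef n g S) ^ 2
      ≤ 1 / 4 := by
    refine le_trans (Finset.sum_le_sum fun S _ => ?_) hVg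
    rw [mul_pow]
    have := pow_le_one₀ (n := 2) (sub_nonneg.2 (he1 S)) (by linarith [he0 S])
    nlinarith [sq_nonneg (fourierCoef n g S)]
  have hcs := Finset.sum_mul_sq_le_sq_mul_sq (Finset.univ.erase (∅ : Finset (Fin n)))
      (fun S => (1 - Real.exp (-t * S.card)) * fourierCoef n g S) (fun S => fourierCoef n f S)
  have hnn : 0 ≤ ∑ S ∈ Finset.univ.erase ∅,
      ((1 - Real.exp (-t * S.card)) * fourierCoef n g S) ^ 2 :=
    Finset.sum_nonneg fun S _ => sq_nonneg _
  have hq2 : q ^ 2 ≤ ∑ S ∈ Finset.univ.erase ∅,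
      ((1 - Real.exp (-t * S.card)) * fourierCoef n g S) ^ 2 := by
    refine hcs.trans ?_
    nlinarith
  have hq4 : q ^ 2 ≤ √t := hq2.trans hsum
  have hq1 : q ^ 2 ≤ 1 := by linarith
  set s := t ^ ((1:ℝ)/4) with hs
  have hs0 : 0 ≤ s := by positivity
  have hss : s ^ 2 = √t := by
    rw [hs, ← Real.rpow_natCast, ← Real.rpow_mul ht.le, Real.sqrt_eq_rpow]
    norm_num
  have hqs : |q| ≤ s := by
    apply abs_le_of_sq_le_sq _ hs0
    rw [hss]; exact hq4
  have hqa : |q| ≤ 1 := by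
    apply abs_le_of_sq_le_sq _ zero_le_one
    simpa using hq1
  have hpa : |p| ≤ 1 / 2 := by
    apply abs_le_of_sq_le_sq _ (by norm_num)
    nlinarith
  have hpq : p * q ≤ 1 / 2 * s := by
    calc p * q ≤ |p * q| := le_abs_self _
      _ = |p| * |q| := abs_mul _ _
      _ ≤ 1 / 2 * s := mul_le_mul hpa hqs (abs_nonneg _) (by norm_num)
  have hqq : q ^ 2 ≤ s := by
    rw [← sq_abs]
    nlinarith [abs_nonneg q]
  rw [hc]
  nlinarith
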